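/- arXiv:2004.10513 — 2 statements merged into one kernel-verified Lean document; each statement's English description precedes it below -/
import Mathlib

section
/- Let M be a monoid. Then M satisfies the right Ore condition if and only if every indecomposable right M-set has at most one fixed point. -/
/-- Two elements of a right `M`-set are connected: related by the equivalence relation
generated by the pairs `(x, x · m)`. -/
def MConn (M : Type*) [Monoid M] {X : Type*} [MulAction Mᵐᵒᵖ X] (a b : X) : Prop :=
  Relation.EqvGen (fun x y => ∃ m : M, y = MulOpposite.op m • x) a b

/-- A right `M`-set is indecomposable if nonempty and any two elements are connected. -/
def MIndec (M : Type*) [Monoid M] (X : Type*) [MulAction Mᵐᵒᵖ X] : Prop :=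
  Nonempty X ∧ ∀ a b : X, MConn M a b

/-- The right Ore condition for a monoid `M`. -/
def RightOre (M : Type*) [Monoid M] : Prop :=
  ∀ m₁ m₂ : M, ∃ n₁ n₂ : M, m₁ * n₁ = m₂ * n₂

theorem MConn.exists_smul_eq_smul {M : Type*} [Monoid M] (h : RightOre M) {X : Type*}
    [MulAction Mᵐᵒᵖ X] {a b : X} (hab : MConn M a b) :
    ∃ m n : M, MulOpposite.op m • a = MulOpposite.op n • b := by
  induction hab with
  | rel x y hxy =>
    obtain ⟨m, rfl⟩ := hxy
    exact ⟨m, 1, by simp⟩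
  | refl x => exact ⟨1, 1, rfl⟩
  | symm x y _ ih =>
    obtain ⟨m, n, e⟩ := ih
    exact ⟨n, m, e.symm⟩
  | trans x y z _ _ ih₁ ih₂ =>
    obtain ⟨a, b, e₁⟩ := ih₁
    obtain ⟨c, d, e₂⟩ := ih₂
    obtain ⟨p, q, e₃⟩ := h b c
    refine ⟨a * p, d * q, ?_⟩
    rw [MulOpposite.op_mul, mul_smul, e₁, ← mul_smul, ← MulOpposite.op_mul, e₃,
      MulOpposite.op_mul, MulOpposite.op_mul, mul_smul, e₂, ← mul_smul]

/-- The right action of a monoid on its predicates by left translation of the argument. -/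
abbrev predicateMulAction (M : Type*) [Monoid M] : MulAction Mᵐᵒᵖ (M → Prop) where
  smul m f := fun n => f (m.unop * n)
  one_smul f := funext fun n => congrArg f (one_mul n)
  mul_smul a b f := funext fun n => congrArg f (mul_assoc b.unop a.unop n)

theorem mIndec_orbit (M : Type*) [Monoid M] {X : Type*} [MulAction Mᵐᵒᵖ X] (x : X) :
    MIndec M (MulAction.orbit Mᵐᵒᵖ x) := by
  have key (a : MulAction.orbit Mᵐᵒᵖ x) : MConn M ⟨x, MulAction.mem_orbit_self x⟩ a := by
    obtain ⟨_, m, rfl⟩ := a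
    exact .rel _ _ ⟨m.unop, rfl⟩
  exact ⟨⟨x, MulAction.mem_orbit_self x⟩, fun a b => .trans _ _ _ (.symm _ _ (key a)) (key b)⟩

theorem stmt11 (M : Type u) [Monoid M] :
    RightOre M ↔
      ∀ (X : Type u) [MulAction Mᵐᵒᵖ X], MIndec M X →
        ∀ x y : X, (∀ m : M, MulOpposite.op m • x = x) →
          (∀ m : M, MulOpposite.op m • y = y) → x = y := by
  constructor
  · intro h X _ hX x y hx hy
    obtain ⟨m, n, e⟩ := (hX.2 x y).exists_smul_eq_smul h
    rwa [hx, hy] at e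
  · intro h m₁ m₂
    by_contra! hne
    let := predicateMulAction M
    let f : M → Prop := fun n => ∃ k, n = m₁ * k
    have h₁ : MulOpposite.op m₁ • f = fun _ => True :=
      funext fun n => eq_true ⟨n, rfl⟩
    have h₂ : MulOpposite.op m₂ • f = fun _ => False :=
      funext fun n => eq_false fun ⟨k, hk⟩ => hne k n hk.symm
    have e := h (MulAction.orbit Mᵐᵒᵖ f) (mIndec_orbit M f)
      ⟨fun _ => True, MulOpposite.op m₁, h₁⟩ ⟨fun _ => False, MulOpposite.op m₂, h₂⟩
      (fun _ => rfl) (fun _ => rfl)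
    exact (congrFun (congrArg Subtype.val e) 1).mp trivial
end

section
/- Let M be a monoid. Then M × M, regarded as a right M-set via the diagonal action (x, y) · m = (x * m, y * m), is indecomposable if and only if for all indecomposable right M-sets X and Y, the product X × Y with the diagonal action (x, y) · m = (x · m, y · m) is indecomposable. -/
/-- A function `f` with `f x` always connected to `f (x · m)` preserves connectedness. -/
theorem MConn.map_of_smul {M X Y : Type*} [Monoid M] [MulAction Mᵐᵒᵖ X] [MulAction Mᵐᵒᵖ Y]
    (f : X → Y) (hf : ∀ x (m : M), MConn M (f x) (f (MulOpposite.op m • x))) {a b : X}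
    (h : MConn M a b) : MConn M (f a) (f b) := by
  induction h with
  | rel x y h =>
    obtain ⟨m, rfl⟩ := h
    exact hf x m
  | refl x => exact .refl _
  | symm x y _ ih => exact .symm _ _ ih
  | trans x y z _ _ ih₁ ih₂ => exact .trans _ _ _ ih₁ ih₂

theorem MIndec.self (M : Type*) [Monoid M] : MIndec M M := by
  have h (a : M) : MConn M 1 a := .rel _ _ ⟨a, by simp⟩
  exact ⟨⟨1⟩, fun a b => .trans _ _ _ (.symm _ _ (h a)) (h b)⟩

/-- If `M × M` is indecomposable, then its equivariant image under
`(m, n) ↦ (x · m, y · n)` is connected. -/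
theorem MIndec.mconn_smul_smul {M X Y : Type*} [Monoid M] [MulAction Mᵐᵒᵖ X]
    [MulAction Mᵐᵒᵖ Y] (h : MIndec M (M × M)) (x : X) (y : Y) (m n : M) :
    MConn M (x, y) (MulOpposite.op m • x, MulOpposite.op n • y) := by
  have key := (h.2 (1, 1) (m, n)).map_of_smul
    (fun p => (MulOpposite.op p.1 • x, MulOpposite.op p.2 • y))
    fun p k => .rel _ _ ⟨k, by simp [mul_smul]⟩
  simpa using key

theorem MIndec.prod {M X Y : Type*} [Monoid M] [MulAction Mᵐᵒᵖ X] [MulAction Mᵐᵒᵖ Y]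
    (h : MIndec M (M × M)) (hX : MIndec M X) (hY : MIndec M Y) : MIndec M (X × Y) := by
  obtain ⟨⟨x⟩, hX⟩ := hX
  obtain ⟨⟨y⟩, hY⟩ := hY
  refine ⟨⟨(x, y)⟩, fun a b => .trans _ (b.1, a.2) _ ?_ ?_⟩
  · exact (hX a.1 b.1).map_of_smul (fun x => (x, a.2)) fun x m => by
      simpa using h.mconn_smul_smul x a.2 m 1
  · exact (hY a.2 b.2).map_of_smul (fun y => (b.1, y)) fun y m => by
      simpa using h.mconn_smul_smul b.1 y 1 m

theorem stmt12 (M : Type u) [Monoid M] :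
    -- `M × M` with the diagonal right action `(x, y) · m = (x * m, y * m)`
    MIndec M (M × M) ↔
      ∀ (X Y : Type u) [MulAction Mᵐᵒᵖ X] [MulAction Mᵐᵒᵖ Y],
        MIndec M X → MIndec M Y → MIndec M (X × Y) := by
  exact ⟨fun h _ _ _ _ hX hY => h.prod hX hY, fun h => h M M (.self M) (.self M)⟩
end
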